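/- arXiv:2510.16728 — 2 statements merged into one kernel-verified Lean document; each statement's English description precedes it below -/
import Mathlib

section
/- Fix x ∈ 𝒳, h > 0 with φ_x(h) > 0, and δ ∈ (0,1). If the sample size satisfies M ≥ 16·B·log(6/δ)/(b·φ_x(h)), then with probability at least 1 − δ over the i.i.d. sample, the stochastic part of the Nadaraya–Watson error satisfies |F̂(x) − F_h(x)| ≤ 8·R·√(2·B·log(6/δ)/(b·φ_x(h)·M)). -/
open MeasureTheory

/-- Moment generating function bound for a bounded function with controlled second moment. -/
lemma integral_exp_mul_le_of_abs_le {Ω : Type*} [MeasurableSpace Ω] (P : Measure Ω)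
    [IsProbabilityMeasure P] {f : Ω → ℝ} (hf : Measurable f) {c v l : ℝ}
    (hc : ∀ᵐ w ∂P, |f w| ≤ c) (hv : ∫ w, f w ^ 2 ∂P ≤ v) (hl : 0 ≤ l) (hlc : l * c ≤ 1) :
    Integrable (fun w => Real.exp (l * f w)) P ∧
      ∫ w, Real.exp (l * f w) ∂P ≤ Real.exp (l * ∫ w, f w ∂P + l ^ 2 * v) := by
  have habs : ∀ᵐ w ∂P, |l * f w| ≤ 1 := by
    filter_upwards [hc] with w hw
    rw [abs_mul, abs_of_nonneg hl]
    exact (mul_le_mul_of_nonneg_left hw hl).trans hlc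
  have hfi : Integrable f P :=
    Integrable.of_bound hf.aestronglyMeasurable c (by simpa using hc)
  have hf2i : Integrable (fun w => f w ^ 2) P := by
    refine Integrable.of_bound (hf.pow_const 2).aestronglyMeasurable (c ^ 2) ?_
    filter_upwards [hc] with w hw
    rw [norm_pow, Real.norm_eq_abs]
    gcongr
  have hei : Integrable (fun w => Real.exp (l * f w)) P := by
    refine Integrable.of_bound (by fun_prop) (Real.exp 1) ?_
    filter_upwards [habs] with w hw
    rw [Real.norm_eq_abs, Real.abs_exp]
    exact Real.exp_le_exp.2 ((le_abs_self _).trans hw)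
  refine ⟨hei, ?_⟩
  have hlin : Integrable (fun w => 1 + l * f w) P := (integrable_const 1).add (hfi.const_mul l)
  calc ∫ w, Real.exp (l * f w) ∂P
      ≤ ∫ w, (1 + l * f w + l ^ 2 * f w ^ 2) ∂P := by
        refine integral_mono_ae hei (hlin.add (hf2i.const_mul _)) ?_
        filter_upwards [habs] with w hw
        have := (abs_le.1 (Real.abs_exp_sub_one_sub_id_le hw)).2
        linarith [mul_pow l (f w) 2]
    _ = 1 + l * ∫ w, f w ∂P + l ^ 2 * ∫ w, f w ^ 2 ∂P := by
        rw [integral_add hlin (hf2i.const_mul _), integral_add (integrable_const 1)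
          (hfi.const_mul l), integral_const_mul, integral_const_mul]
        simp
    _ ≤ (l * ∫ w, f w ∂P + l ^ 2 * v) + 1 := by
        linarith [mul_le_mul_of_nonneg_left hv (sq_nonneg l)]
    _ ≤ _ := Real.add_one_le_exp _

/-- Chernoff bound for sums of i.i.d. bounded variables with controlled second moment. -/
lemma measureReal_pi_le_sum_le_exp {Ω : Type*} [MeasurableSpace Ω] (P : Measure Ω)
    [IsProbabilityMeasure P] {f : Ω → ℝ} (hf : Measurable f) {c v l : ℝ}
    (hc : ∀ᵐ w ∂P, |f w| ≤ c) (hv : ∫ w, f w ^ 2 ∂P ≤ v) (hl : 0 ≤ l) (hlc : l * c ≤ 1)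
    (M : ℕ) (t : ℝ) :
    (Measure.pi fun _ : Fin M => P).real {ω | t ≤ ∑ i, f (ω i)} ≤
      Real.exp (M * (l * ∫ w, f w ∂P + l ^ 2 * v) - l * t) := by
  obtain ⟨hei, hle⟩ := integral_exp_mul_le_of_abs_le P hf hc hv hl hlc
  have hexp : (fun ω : Fin M → Ω => Real.exp (l * ∑ i, f (ω i))) =
      fun ω => ∏ i, Real.exp (l * f (ω i)) := by
    funext ω
    rw [Finset.mul_sum, Real.exp_sum]
  have hint : Integrable (fun ω : Fin M → Ω => Real.exp (l * ∑ i, f (ω i)))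
      (Measure.pi fun _ => P) := by
    rw [hexp]
    exact Integrable.fintype_prod fun _ => hei
  refine (ProbabilityTheory.measure_ge_le_exp_mul_mgf t hl hint).trans ?_
  have hmgf : ProbabilityTheory.mgf (fun ω : Fin M → Ω => ∑ i, f (ω i))
      (Measure.pi fun _ => P) l = (∫ w, Real.exp (l * f w) ∂P) ^ M := by
    rw [ProbabilityTheory.mgf, hexp, integral_fintype_prod_eq_pow
      (fun w => Real.exp (l * f w)), Fintype.card_fin]
  rw [hmgf, sub_eq_neg_add, Real.exp_add, Real.exp_nat_mul, neg_mul]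
  gcongr

/-- A weighted average is close to `F` when the centred weighted sum is small and the total weight
is at least half of its expected value. -/
lemma abs_div_sub_le_of_abs_sum_le {M : ℕ} {y w : Fin M → ℝ} {F p s R : ℝ}
    (hp : 0 < M * p) (hw : M * p / 2 < ∑ i, w i)
    (hz : |∑ i, (y i - F) * w i| ≤ M * (4 * R * s * p)) :
    |(∑ i, y i * w i) / (∑ i, w i) - F| ≤ 8 * R * s := by
  have hW : 0 < ∑ i, w i := by linarith
  have hsum : (∑ i, y i * w i) / (∑ i, w i) - F = (∑ i, (y i - F) * w i) / ∑ i, w i := by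
    simp only [sub_mul, Finset.sum_sub_distrib, ← Finset.mul_sum]
    field_simp
  have hRs : 0 ≤ R * s := by
    have := (abs_nonneg _).trans hz
    by_contra! hneg
    nlinarith [mul_pos hp (neg_pos.2 hneg)]
  rw [hsum, abs_div, abs_of_pos hW, div_le_iff₀ hW]
  nlinarith [mul_le_mul_of_nonneg_left hw.le hRs]

/-- high-probability bound on the stochastic part
`|F̂(x) − F_h(x)|` of the Nadaraya–Watson error. -/
theorem nadaraya_watson_stochastic_part_bound
    {𝒳 : Type*} [MeasurableSpace 𝒳]
    (ρ : 𝒳 → 𝒳 → ℝ)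
    (hρ_meas : Measurable fun p : 𝒳 × 𝒳 => ρ p.1 p.2)
    (hρ_nonneg : ∀ u v, 0 ≤ ρ u v)
    (hρ_symm : ∀ u v, ρ u v = ρ v u)
    (hρ_refl : ∀ u, ρ u u = 0)
    (hρ_tri : ∀ u v w, ρ u w ≤ ρ u v + ρ v w)
    (P : Measure (𝒳 × ℝ)) [IsProbabilityMeasure P]
    (R : ℝ) (hR : 0 < R)
    (hY : ∀ᵐ p ∂P, |p.2| ≤ R)
    (K : ℝ → ℝ) (hK_meas : Measurable K) (hK_nonneg : ∀ u, 0 ≤ K u)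
    (b B : ℝ) (hb : 0 < b) (hbB : b ≤ B)
    (hK_bounds : ∀ u : ℝ, 0 ≤ u →
      (Set.Icc (0:ℝ) 1).indicator (fun _ => b) u ≤ K u ∧
      K u ≤ (Set.Icc (0:ℝ) 1).indicator (fun _ => B) u)
    (x : 𝒳) (h : ℝ) (hh : 0 < h)
    (φ : ℝ) (hφ_def : φ = ((P.map Prod.fst) {z | ρ z x ≤ h}).toReal)
    (hφ_pos : 0 < φ)
    (δ : ℝ) (hδ : δ ∈ Set.Ioo (0:ℝ) 1)
    (M : ℕ) (hM : 16 * B * Real.log (6 / δ) / (b * φ) ≤ (M : ℝ)) :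
    (Measure.pi fun _ : Fin M => P)
      {ω | |(∑ i, (ω i).2 * K (h⁻¹ * ρ x (ω i).1)) /
              (∑ j, K (h⁻¹ * ρ x (ω j).1))
            - (∫ z, K (h⁻¹ * ρ x z) ∂(P.map Prod.fst))⁻¹ *
                (∫ p, p.2 * K (h⁻¹ * ρ x p.1) ∂P)|
          ≤ 8 * R * Real.sqrt (2 * B * Real.log (6 / δ) / (b * φ * M))}
      ≥ ENNReal.ofReal (1 - δ) := by
  obtain ⟨hδ0, hδ1⟩ := hδ
  have hB : 0 < B := hb.trans_le hbB
  set L := Real.log (6 / δ) with hL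
  have hLpos : 0 < L := Real.log_pos (by rw [lt_div_iff₀ hδ0]; linarith)
  have hexpL : Real.exp (-L) = δ / 6 := by
    rw [hL, Real.exp_neg, Real.exp_log (by positivity), inv_div]
  have hMpos : (0 : ℝ) < M := lt_of_lt_of_le (by positivity) hM
  have hρx : Measurable (ρ x) := hρ_meas.comp measurable_prodMk_left
  have hKx : Measurable fun z => K (h⁻¹ * ρ x z) := hK_meas.comp (hρx.const_mul _)
  let w : 𝒳 × ℝ → ℝ := fun q => K (h⁻¹ * ρ x q.1)
  have hw_meas : Measurable w := hKx.comp measurable_fst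
  have hw0 (q) : 0 ≤ w q := hK_nonneg _
  have hscaled (z) : 0 ≤ h⁻¹ * ρ x z := mul_nonneg (inv_nonneg.2 hh.le) (hρ_nonneg _ _)
  have hwB (q) : w q ≤ B := (hK_bounds _ (hscaled q.1)).2.trans
    (Set.indicator_le_self' (fun _ _ => hB.le) _)
  have hwabs (q) : |w q| ≤ B := by rw [abs_of_nonneg (hw0 q)]; exact hwB q
  have hwi : Integrable w P :=
    Integrable.of_bound hw_meas.aestronglyMeasurable B (.of_forall hwabs)
  set p := ∫ z, K (h⁻¹ * ρ x z) ∂(P.map Prod.fst)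
  have hpw : p = ∫ q, w q ∂P :=
    integral_map measurable_fst.aemeasurable hKx.aestronglyMeasurable
  have hpφ : b * φ ≤ p := by
    have hball : MeasurableSet {z | ρ z x ≤ h} := by
      simp only [hρ_symm _ x]
      exact measurableSet_le hρx measurable_const
    have hφ_int : b * φ = ∫ z, {z | ρ z x ≤ h}.indicator (fun _ => b) z ∂(P.map Prod.fst) := by
      rw [integral_indicator_const _ hball, hφ_def, smul_eq_mul, mul_comm]; rfl
    have : IsProbabilityMeasure (P.map Prod.fst) :=
      Measure.isProbabilityMeasure_map measurable_fst.aemeasurable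
    rw [hφ_int]
    refine integral_mono ((integrable_const b).indicator hball)
      (Integrable.of_bound hKx.aestronglyMeasurable B (.of_forall fun z => hwabs (z, 0)))
      fun z => ?_
    by_cases hz : ρ z x ≤ h
    · have hmem : h⁻¹ * ρ x z ∈ Set.Icc (0 : ℝ) 1 :=
        ⟨hscaled z, by rw [inv_mul_le_iff₀ hh, mul_one, hρ_symm]; exact hz⟩
      have := (hK_bounds _ (hscaled z)).1
      rw [Set.indicator_of_mem hmem] at this
      simpa [Set.indicator, hz] using this
    · simpa [Set.indicator, hz] using hK_nonneg _
  have hbφ : 0 < b * φ := mul_pos hb hφ_pos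
  have hp : 0 < p := hbφ.trans_le hpφ
  set F := p⁻¹ * ∫ q, q.2 * K (h⁻¹ * ρ x q.1) ∂P
  have hyw_le : ∀ᵐ q ∂P, ‖q.2 * w q‖ ≤ R * w q := by
    filter_upwards [hY] with q hq
    rw [norm_mul, Real.norm_eq_abs, Real.norm_eq_abs, abs_of_nonneg (hw0 q)]
    exact mul_le_mul_of_nonneg_right hq (hw0 q)
  have hywi : Integrable (fun q => q.2 * w q) P :=
    (hwi.const_mul R).mono' (by fun_prop) hyw_le
  have hpF : p * F = ∫ q, q.2 * w q ∂P := mul_inv_cancel_left₀ hp.ne' _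
  have hFR : |F| ≤ R := by
    have := norm_integral_le_of_norm_le (hwi.const_mul R) hyw_le
    rw [← hpF, integral_const_mul, ← hpw, norm_mul, Real.norm_of_nonneg hp.le, mul_comm R] at this
    exact le_of_mul_le_mul_left this hp
  set s := √(2 * B * L / (b * φ * M)) with hs_def
  have hs0 : 0 ≤ s := Real.sqrt_nonneg _
  have hs2 : b * φ * M * s ^ 2 = 2 * B * L := by
    rw [hs_def, Real.sq_sqrt (by positivity)]
    field_simp
  rw [div_le_iff₀ hbφ] at hM
  have hs1 : s ≤ 1 := by
    by_contra! hs
    have : b * φ * M * 1 < b * φ * M * s ^ 2 := by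
      gcongr
      nlinarith
    nlinarith [mul_pos hB hLpos]
  have hMp : M * (b * φ) ≤ M * p := by gcongr
  let Z : 𝒳 × ℝ → ℝ := fun q => (q.2 - F) * w q
  have hZ_meas : Measurable Z := (measurable_snd.sub_const F).mul hw_meas
  have hYF : ∀ᵐ q ∂P, |q.2 - F| ≤ 2 * R := by
    filter_upwards [hY] with q hq
    linarith [abs_sub q.2 F]
  have hZ_abs : ∀ᵐ q ∂P, |Z q| ≤ 2 * R * B := by
    filter_upwards [hYF] with q hq
    rw [abs_mul]
    exact mul_le_mul hq (hwabs q) (abs_nonneg _) (by positivity)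
  have hZ_mean : ∫ q, Z q ∂P = 0 := by
    simp only [Z, sub_mul]
    rw [integral_sub hywi (hwi.const_mul F), integral_const_mul, ← hpF, ← hpw]
    ring
  have hw_sq : ∫ q, w q ^ 2 ∂P ≤ B * p := by
    rw [hpw, ← integral_const_mul]
    refine integral_mono_of_nonneg (.of_forall fun q => sq_nonneg _) (hwi.const_mul B)
      (.of_forall fun q => ?_)
    simp only [sq]
    exact mul_le_mul_of_nonneg_right (hwB q) (hw0 q)
  have hZ_sq : ∫ q, Z q ^ 2 ∂P ≤ 4 * R ^ 2 * B * p := by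
    rw [hpw, ← integral_const_mul]
    refine integral_mono_of_nonneg (.of_forall fun q => sq_nonneg _) (hwi.const_mul _) ?_
    filter_upwards [hYF] with q hq
    have hsq : (q.2 - F) ^ 2 ≤ (2 * R) ^ 2 := sq_le_sq' (abs_le.1 hq).1 (abs_le.1 hq).2
    have hwq : w q ^ 2 ≤ B * w q := by
      rw [sq]
      exact mul_le_mul_of_nonneg_right (hwB q) (hw0 q)
    simp only [Z, mul_pow (q.2 - F)]
    calc (q.2 - F) ^ 2 * w q ^ 2 ≤ (2 * R) ^ 2 * (B * w q) := by gcongr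
      _ = 4 * R ^ 2 * B * w q := by ring
  have hexponent : M * (s / (2 * R * B) * 0 + (s / (2 * R * B)) ^ 2 * (4 * R ^ 2 * B * p))
      - s / (2 * R * B) * (M * (4 * R * s * p)) ≤ -L := by
    have heq : M * (s / (2 * R * B) * 0 + (s / (2 * R * B)) ^ 2 * (4 * R ^ 2 * B * p))
      - s / (2 * R * B) * (M * (4 * R * s * p)) = -(M * p * s ^ 2 / B) := by
      field_simp
      ring
    rw [heq, neg_le_neg_iff, le_div_iff₀ hB]
    nlinarith [mul_le_mul_of_nonneg_right hMp (sq_nonneg s), mul_pos hB hLpos]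
  set μ := Measure.pi fun _ : Fin M => P
  have hupper : μ.real {ω | M * (4 * R * s * p) ≤ ∑ i, Z (ω i)} ≤ δ / 6 := by
    refine (measureReal_pi_le_sum_le_exp P hZ_meas hZ_abs hZ_sq (l := s / (2 * R * B))
      (by positivity) (by rwa [div_mul_cancel₀ _ (by positivity)]) M _).trans ?_
    rw [hZ_mean, ← hexpL]
    exact Real.exp_le_exp.2 hexponent
  have hlower : μ.real {ω | M * (4 * R * s * p) ≤ ∑ i, -Z (ω i)} ≤ δ / 6 := by
    refine (measureReal_pi_le_sum_le_exp P hZ_meas.neg (by simpa using hZ_abs)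
      (by simpa using hZ_sq) (l := s / (2 * R * B))
      (by positivity) (by rwa [div_mul_cancel₀ _ (by positivity)]) M _).trans ?_
    simp only [Pi.neg_apply]
    rw [integral_neg, hZ_mean, neg_zero, ← hexpL]
    exact Real.exp_le_exp.2 hexponent
  have hweight : μ.real {ω | -(M * p / 2) ≤ ∑ i, -w (ω i)} ≤ δ / 6 := by
    refine (measureReal_pi_le_sum_le_exp P hw_meas.neg (c := B)
      (.of_forall fun q => by simpa using hwabs q)
      (by simpa using hw_sq) (l := 1 / (4 * B))
      (by positivity) (by field_simp; norm_num) M _).trans ?_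
    simp only [Pi.neg_apply]
    rw [integral_neg, ← hpw, ← hexpL]
    refine Real.exp_le_exp.2 ?_
    have heq : M * (1 / (4 * B) * -p + (1 / (4 * B)) ^ 2 * (B * p))
        - 1 / (4 * B) * -(M * p / 2) = -(M * p / (16 * B)) := by
      field_simp
      ring
    rw [heq, neg_le_neg_iff, le_div_iff₀ (by positivity)]
    linarith
  set G := {ω : Fin M → 𝒳 × ℝ | |(∑ i, (ω i).2 * K (h⁻¹ * ρ x (ω i).1)) /
    (∑ j, K (h⁻¹ * ρ x (ω j).1)) - F| ≤ 8 * R * s}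
  have hcover : Set.univ ⊆ G ∪ ({ω | M * (4 * R * s * p) ≤ ∑ i, Z (ω i)} ∪
      ({ω | M * (4 * R * s * p) ≤ ∑ i, -Z (ω i)} ∪
        {ω | -(M * p / 2) ≤ ∑ i, -w (ω i)})) := by
    intro ω _
    by_contra hω
    simp only [Set.mem_union, Set.mem_ofPred_eq, not_or, not_le, Finset.sum_neg_distrib] at hω
    obtain ⟨hωG, hω₁, hω₂, hω₃⟩ := hω
    exact hωG (abs_div_sub_le_of_abs_sum_le (y := fun i => (ω i).2) (w := fun i => w (ω i))
      (mul_pos hMpos hp) (by linarith) (abs_le.2 ⟨by linarith, hω₁.le⟩))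
  have hone : 1 ≤ μ.real G + (δ / 6 + (δ / 6 + δ / 6)) := by
    rw [← probReal_univ (μ := μ)]
    refine (measureReal_mono hcover).trans ((measureReal_union_le _ _).trans ?_)
    gcongr
    refine (measureReal_union_le _ _).trans ?_
    gcongr
    refine (measureReal_union_le _ _).trans ?_
    gcongr
  exact ENNReal.ofReal_le_of_le_toReal (by change _ ≤ μ.real G; linarith)
end

section
/- Let 𝓡 > 0 and let X be a random continuously differentiable path [0,T] → ℝ^d (defined on some probability space, measurably) with ‖X‖_{1-var} ≤ 𝓡 almost surely. Set C = (e^𝓡 + 𝓡·e^{2𝓡})^{−1}. Then for every deterministic continuously differentiable path x with ‖x‖_{1-var} ≤ 𝓡, every truncation level N ∈ ℕ, and every h > 0: ℙ[ρ^Sig_{≤N}(X,x) ≤ h] ≥ ℙ[ρ^Sig(X,x) ≤ h] ≥ ℙ[‖X − x‖_{1-var} ≤ C·h]. -/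
open MeasureTheory

/-- Iterated integral for the word `[i_1, …, i_k]`; the head of the list is the
*outermost* integration variable. -/
noncomputable def sigAux {ι : Type*} (x' : ℝ → ι → ℝ) : List ι → ℝ → ℝ
  | [], _ => 1
  | i :: w, t => ∫ s in (0:ℝ)..t, x' s i * sigAux x' w s

/-- Signature coefficient `Sig^w(x)` for the word `w = [i₁, …, i_k]`, expressed
through the derivative `x'` of the path. -/
noncomputable def sigCoeff {ι : Type*} (x' : ℝ → ι → ℝ) (T : ℝ) (w : List ι) : ℝ :=
  sigAux x' w.reverse T

/-- Signature distance `ρ^Sig(x,y) ∈ [0,∞]` of two paths, expressed through the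
derivatives `x'`, `y'`. -/
noncomputable def rhoSig {d : ℕ} (x' y' : ℝ → Fin d → ℝ) (T : ℝ) : ENNReal :=
  (∑' k : ℕ, ∑ w : Fin k → Fin d,
      ENNReal.ofReal ((sigCoeff x' T (List.ofFn w) - sigCoeff y' T (List.ofFn w)) ^ 2))
    ^ (1 / 2 : ℝ)

/-- Truncated signature distance `ρ^Sig_{≤N}(x,y)` at level `N`. -/
noncomputable def rhoSigTrunc {d : ℕ} (x' y' : ℝ → Fin d → ℝ) (T : ℝ) (N : ℕ) : ℝ :=
  Real.sqrt (∑ k ∈ Finset.range (N + 1), ∑ w : Fin k → Fin d,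
    (sigCoeff x' T (List.ofFn w) - sigCoeff y' T (List.ofFn w)) ^ 2)

/-- 1-variation of a path, expressed through its derivative `x'`. -/
noncomputable def oneVar {d : ℕ} (x' : ℝ → Fin d → ℝ) (T : ℝ) : ℝ :=
  ∫ t in (0:ℝ)..T, Real.sqrt (∑ i, (x' t i) ^ 2)

/-- The Euclidean norm of a finite family of reals. -/
noncomputable def euclNorm {κ : Type*} [Fintype κ] (v : κ → ℝ) : ℝ :=
  Real.sqrt (∑ i, v i ^ 2)

section EuclNorm

variable {κ μ : Type*} [Fintype κ] [Fintype μ]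

lemma euclNorm_eq_norm (v : κ → ℝ) : euclNorm v = ‖WithLp.toLp 2 v‖ := by
  simp [euclNorm, EuclideanSpace.norm_eq]

lemma euclNorm_nonneg (v : κ → ℝ) : 0 ≤ euclNorm v := Real.sqrt_nonneg _

lemma sq_euclNorm (v : κ → ℝ) : euclNorm v ^ 2 = ∑ i, v i ^ 2 :=
  Real.sq_sqrt (Finset.sum_nonneg fun _ _ => sq_nonneg _)

lemma euclNorm_add_le (v w : κ → ℝ) :
    euclNorm (fun i => v i + w i) ≤ euclNorm v + euclNorm w := by
  simp only [euclNorm_eq_norm]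
  exact norm_add_le (WithLp.toLp 2 v) (WithLp.toLp 2 w)

lemma euclNorm_comp_equiv (e : κ ≃ μ) (v : μ → ℝ) :
    euclNorm (fun i => v (e i)) = euclNorm v := by
  rw [euclNorm, euclNorm, e.sum_comp fun j => v j ^ 2]

lemma euclNorm_mul (v : κ → ℝ) (w : μ → ℝ) :
    euclNorm (fun p : κ × μ => v p.1 * w p.2) = euclNorm v * euclNorm w := by
  rw [euclNorm, euclNorm, euclNorm, ← Real.sqrt_mul (Finset.sum_nonneg fun _ _ => sq_nonneg _),
    Fintype.sum_prod_type, Finset.sum_mul_sum]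
  simp only [mul_pow]

lemma continuous_euclNorm {f : ℝ → κ → ℝ} (hf : ∀ i, Continuous fun t => f t i) :
    Continuous fun t => euclNorm (f t) :=
  Real.continuous_sqrt.comp (continuous_finsetSum _ fun i _ => (hf i).pow 2)

lemma euclNorm_integral_le {f : ℝ → κ → ℝ} (hf : ∀ i, Continuous fun t => f t i)
    {t : ℝ} (ht : 0 ≤ t) :
    euclNorm (fun i => ∫ s in (0:ℝ)..t, f s i) ≤ ∫ s in (0:ℝ)..t, euclNorm (f s) := by
  have hcont : Continuous fun s => WithLp.toLp 2 (f s) :=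
    (PiLp.continuous_toLp 2 fun _ : κ => ℝ).comp (continuous_pi hf)
  have hint : WithLp.toLp 2 (fun i => ∫ s in (0:ℝ)..t, f s i)
      = ∫ s in (0:ℝ)..t, WithLp.toLp 2 (f s) := by
    ext i
    exact (EuclideanSpace.proj (𝕜 := ℝ) i).intervalIntegral_comp_comm
      (hcont.intervalIntegrable 0 t)
  simp only [euclNorm_eq_norm]
  rw [hint]
  exact intervalIntegral.norm_integral_le_integral_norm ht

end EuclNorm

section Signature

variable {ι : Type*}

lemma continuous_sigAux {x : ℝ → ι → ℝ} (hx : ∀ i, Continuous fun t => x t i) (w : List ι) :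
    Continuous (sigAux x w) := by
  induction w with
  | nil => exact continuous_const
  | cons i w ih =>
    exact intervalIntegral.continuous_primitive
      (fun a b => ((hx i).mul ih).intervalIntegrable a b) 0

lemma sigAux_congr {x y : ℝ → ι → ℝ} {T : ℝ} (hxy : ∀ t ∈ Set.Icc 0 T, x t = y t) (w : List ι) :
    ∀ t ∈ Set.Icc 0 T, sigAux x w t = sigAux y w t := by
  induction w with
  | nil => exact fun _ _ => rfl
  | cons i w ih =>
    intro t ht
    refine intervalIntegral.integral_congr fun s hs => ?_
    rw [Set.uIcc_of_le ht.1] at hs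
    have hsT : s ∈ Set.Icc 0 T := ⟨hs.1, hs.2.trans ht.2⟩
    simp only [hxy s hsT, ih s hsT]

end Signature

section Bounds

variable {d : ℕ}

/-- Words of length `k + 1` as a first letter followed by a word of length `k`. -/
def consWordEquiv (d k : ℕ) : Fin d × (Fin k → Fin d) ≃ (Fin (k + 1) → Fin d) :=
  Fin.consEquiv fun _ => Fin d

/-- The family of iterated integrals over all words of length `k`. -/
noncomputable def sigLevel (x : ℝ → Fin d → ℝ) (k : ℕ) (t : ℝ) (w : Fin k → Fin d) : ℝ :=
  sigAux x (List.ofFn w) t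

lemma continuous_sigLevel {x : ℝ → Fin d → ℝ} (hx : ∀ i, Continuous fun t => x t i) {k : ℕ}
    (w : Fin k → Fin d) : Continuous fun t => sigLevel x k t w :=
  continuous_sigAux hx _

lemma sigLevel_succ (x : ℝ → Fin d → ℝ) (k : ℕ) (t : ℝ) (p : Fin d × (Fin k → Fin d)) :
    sigLevel x (k + 1) t (consWordEquiv d k p)
      = ∫ s in (0:ℝ)..t, x s p.1 * sigLevel x k s p.2 := by
  simp [sigLevel, consWordEquiv, Fin.consEquiv, List.ofFn_succ, sigAux]

lemma euclNorm_sigLevel_succ_le {x : ℝ → Fin d → ℝ} (hx : ∀ i, Continuous fun t => x t i)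
    (k : ℕ) {t : ℝ} (ht : 0 ≤ t) :
    euclNorm (sigLevel x (k + 1) t)
      ≤ ∫ s in (0:ℝ)..t, euclNorm (x s) * euclNorm (sigLevel x k s) := by
  rw [← euclNorm_comp_equiv (consWordEquiv d k)]
  simp only [sigLevel_succ, ← euclNorm_mul]
  exact euclNorm_integral_le (fun p : Fin d × (Fin k → Fin d) =>
    (hx p.1).mul (continuous_sigLevel hx p.2)) ht

lemma euclNorm_sigLevel_sub_succ_le {x y : ℝ → Fin d → ℝ}
    (hx : ∀ i, Continuous fun t => x t i) (hy : ∀ i, Continuous fun t => y t i)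
    (k : ℕ) {t : ℝ} (ht : 0 ≤ t) :
    euclNorm (fun w => sigLevel x (k + 1) t w - sigLevel y (k + 1) t w)
      ≤ ∫ s in (0:ℝ)..t, (euclNorm (fun i => x s i - y s i) * euclNorm (sigLevel x k s)
        + euclNorm (y s) * euclNorm (fun w => sigLevel x k s w - sigLevel y k s w)) := by
  have hcx : ∀ p : Fin d × (Fin k → Fin d), Continuous fun s => x s p.1 * sigLevel x k s p.2 :=
    fun p => (hx p.1).mul (continuous_sigLevel hx p.2)
  have hcy : ∀ p : Fin d × (Fin k → Fin d), Continuous fun s => y s p.1 * sigLevel y k s p.2 :=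
    fun p => (hy p.1).mul (continuous_sigLevel hy p.2)
  have hc₁ : Continuous fun s => euclNorm fun p : Fin d × (Fin k → Fin d) =>
      (x s p.1 - y s p.1) * sigLevel x k s p.2 :=
    continuous_euclNorm fun p => ((hx p.1).sub (hy p.1)).mul (continuous_sigLevel hx p.2)
  have hc₂ : Continuous fun s => euclNorm fun p : Fin d × (Fin k → Fin d) =>
      y s p.1 * (sigLevel x k s p.2 - sigLevel y k s p.2) :=
    continuous_euclNorm fun p =>
      (hy p.1).mul ((continuous_sigLevel hx p.2).sub (continuous_sigLevel hy p.2))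
  rw [← euclNorm_comp_equiv (consWordEquiv d k)]
  simp only [sigLevel_succ, ← euclNorm_mul]
  have hsub : ∀ p : Fin d × (Fin k → Fin d), (∫ s in (0:ℝ)..t, x s p.1 * sigLevel x k s p.2)
      - (∫ s in (0:ℝ)..t, y s p.1 * sigLevel y k s p.2)
      = ∫ s in (0:ℝ)..t, (x s p.1 * sigLevel x k s p.2 - y s p.1 * sigLevel y k s p.2) :=
    fun p => (intervalIntegral.integral_sub ((hcx p).intervalIntegrable 0 t)
      ((hcy p).intervalIntegrable 0 t)).symm
  simp only [hsub]
  refine (euclNorm_integral_le (fun p => (hcx p).sub (hcy p)) ht).trans ?_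
  refine intervalIntegral.integral_mono_on ht
    ((continuous_euclNorm fun p => (hcx p).sub (hcy p)).intervalIntegrable 0 t)
    ((hc₁.add hc₂).intervalIntegrable 0 t)
    fun s _ => ?_
  refine le_of_eq_of_le ?_ (euclNorm_add_le _ _)
  congr 1
  funext p
  simp only [Pi.sub_apply]
  ring

lemma hasDerivAt_primitive {a : ℝ → ℝ} (ha : Continuous a) (t : ℝ) :
    HasDerivAt (fun u => ∫ s in (0:ℝ)..u, a s) (a t) t :=
  intervalIntegral.integral_hasDerivAt_right (ha.intervalIntegrable 0 t)
    (ha.stronglyMeasurableAtFilter _ _) ha.continuousAt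

lemma hasDerivAt_primitive_pow {a : ℝ → ℝ} (ha : Continuous a) (k : ℕ) (t : ℝ) :
    HasDerivAt (fun u => (∫ s in (0:ℝ)..u, a s) ^ (k + 1) / ((k + 1).factorial : ℝ))
      (a t * ((∫ s in (0:ℝ)..t, a s) ^ k / (k.factorial : ℝ))) t := by
  refine (((hasDerivAt_primitive ha t).pow (k + 1)).div_const _).congr_deriv ?_
  have : (k.factorial : ℝ) ≠ 0 := by positivity
  have : (k : ℝ) + 1 ≠ 0 := by positivity
  rw [Nat.factorial_succ]
  push_cast
  field_simp

lemma integral_mul_primitive_pow {a : ℝ → ℝ} (ha : Continuous a) (k : ℕ) (t : ℝ) :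
    ∫ s in (0:ℝ)..t, a s * ((∫ u in (0:ℝ)..s, a u) ^ k / (k.factorial : ℝ))
      = (∫ s in (0:ℝ)..t, a s) ^ (k + 1) / ((k + 1).factorial : ℝ) := by
  have hL : Continuous fun s => ∫ u in (0:ℝ)..s, a u :=
    intervalIntegral.continuous_primitive (fun p q => ha.intervalIntegrable p q) 0
  rw [intervalIntegral.integral_eq_sub_of_hasDerivAt
    (fun s _ => hasDerivAt_primitive_pow ha k s)
    ((ha.mul ((hL.pow k).div_const _)).intervalIntegrable 0 t)]
  simp

lemma integral_mul_primitive_pow_add {a c : ℝ → ℝ} (ha : Continuous a) (hc : Continuous c)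
    (k : ℕ) (t : ℝ) :
    ∫ s in (0:ℝ)..t, (c s * ((∫ u in (0:ℝ)..s, a u) ^ (k + 1) / ((k + 1).factorial : ℝ))
        + a s * ((∫ u in (0:ℝ)..s, c u) * ((∫ u in (0:ℝ)..s, a u) ^ k / (k.factorial : ℝ))))
      = (∫ s in (0:ℝ)..t, c s)
        * ((∫ s in (0:ℝ)..t, a s) ^ (k + 1) / ((k + 1).factorial : ℝ)) := by
  have hL : Continuous fun s => ∫ u in (0:ℝ)..s, a u :=
    intervalIntegral.continuous_primitive (fun p q => ha.intervalIntegrable p q) 0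
  have hD : Continuous fun s => ∫ u in (0:ℝ)..s, c u :=
    intervalIntegral.continuous_primitive (fun p q => hc.intervalIntegrable p q) 0
  rw [intervalIntegral.integral_eq_sub_of_hasDerivAt
    (f := fun t => (∫ s in (0:ℝ)..t, c s)
        * ((∫ s in (0:ℝ)..t, a s) ^ (k + 1) / ((k + 1).factorial : ℝ)))
    (fun s _ => ((hasDerivAt_primitive hc s).mul
      (hasDerivAt_primitive_pow ha k s)).congr_deriv (by ring))
    (Continuous.intervalIntegrable (by fun_prop) 0 t)]
  simp

lemma euclNorm_sigLevel_le {x : ℝ → Fin d → ℝ} {a : ℝ → ℝ}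
    (hx : ∀ i, Continuous fun t => x t i) (ha : Continuous a)
    (hxa : ∀ s, euclNorm (x s) ≤ a s) (k : ℕ) :
    ∀ t, 0 ≤ t → euclNorm (sigLevel x k t)
      ≤ (∫ s in (0:ℝ)..t, a s) ^ k / (k.factorial : ℝ) := by
  have hL : Continuous fun s => ∫ u in (0:ℝ)..s, a u :=
    intervalIntegral.continuous_primitive (fun p q => ha.intervalIntegrable p q) 0
  induction k with
  | zero => intro t _; simp [euclNorm, sigLevel, sigAux]
  | succ k ih =>
    intro t ht
    refine (euclNorm_sigLevel_succ_le hx k ht).trans ?_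
    rw [← integral_mul_primitive_pow ha]
    refine intervalIntegral.integral_mono_on ht
      (((continuous_euclNorm hx).mul
        (continuous_euclNorm fun w => continuous_sigLevel hx w)).intervalIntegrable 0 t)
      ((ha.mul ((hL.pow k).div_const _)).intervalIntegrable 0 t) fun s hs => ?_
    exact mul_le_mul (hxa s) (ih s hs.1) (euclNorm_nonneg _) ((euclNorm_nonneg _).trans (hxa s))

lemma euclNorm_sigLevel_zero_sub (x y : ℝ → Fin d → ℝ) (t : ℝ) :
    euclNorm (fun w => sigLevel x 0 t w - sigLevel y 0 t w) = 0 := by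
  simp [euclNorm, sigLevel, sigAux]

lemma euclNorm_sigLevel_sub_le {x y : ℝ → Fin d → ℝ} {a : ℝ → ℝ}
    (hx : ∀ i, Continuous fun t => x t i) (hy : ∀ i, Continuous fun t => y t i)
    (ha : Continuous a) (hxa : ∀ s, euclNorm (x s) ≤ a s) (hya : ∀ s, euclNorm (y s) ≤ a s)
    (k : ℕ) :
    ∀ t, 0 ≤ t → euclNorm (fun w => sigLevel x (k + 1) t w - sigLevel y (k + 1) t w)
      ≤ (∫ s in (0:ℝ)..t, euclNorm fun i => x s i - y s i)
        * ((∫ s in (0:ℝ)..t, a s) ^ k / (k.factorial : ℝ)) := by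
  have hc : Continuous fun s => euclNorm fun i => x s i - y s i :=
    continuous_euclNorm fun i => (hx i).sub (hy i)
  have hL : Continuous fun s => ∫ u in (0:ℝ)..s, a u :=
    intervalIntegral.continuous_primitive (fun p q => ha.intervalIntegrable p q) 0
  have hD : Continuous fun s => ∫ u in (0:ℝ)..s, euclNorm fun i => x u i - y u i :=
    intervalIntegral.continuous_primitive (fun p q => hc.intervalIntegrable p q) 0
  induction k with
  | zero =>
    intro t ht
    refine (euclNorm_sigLevel_sub_succ_le hx hy 0 ht).trans_eq ?_
    simp_rw [euclNorm_sigLevel_zero_sub]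
    simp [euclNorm, sigLevel, sigAux]
  | succ k ih =>
    intro t ht
    refine (euclNorm_sigLevel_sub_succ_le hx hy (k + 1) ht).trans ?_
    rw [← integral_mul_primitive_pow_add ha hc]
    refine intervalIntegral.integral_mono_on ht
      (Continuous.intervalIntegrable (.add
        (hc.mul (continuous_euclNorm fun w => continuous_sigLevel hx w))
        ((continuous_euclNorm hy).mul (continuous_euclNorm fun w =>
          (continuous_sigLevel hx w).sub (continuous_sigLevel hy w)))) 0 t)
      (Continuous.intervalIntegrable (by fun_prop) 0 t) fun s hs => ?_
    exact add_le_add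
      (mul_le_mul_of_nonneg_left (euclNorm_sigLevel_le hx ha hxa _ s hs.1) (euclNorm_nonneg _))
      (mul_le_mul (hya s) (ih s hs.1) (euclNorm_nonneg _) ((euclNorm_nonneg _).trans (hya s)))

end Bounds

section Distance

variable {d : ℕ}

lemma sigCoeff_ofFn (x : ℝ → Fin d → ℝ) (T : ℝ) {k : ℕ} (w : Fin k → Fin d) :
    sigCoeff x T (List.ofFn w)
      = sigLevel x k T (Fin.revPerm.arrowCongr (Equiv.refl (Fin d)) w) := by
  have hrev : (List.ofFn w).reverse
      = List.ofFn (Fin.revPerm.arrowCongr (Equiv.refl (Fin d)) w) := by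
    refine List.ext_getElem (by simp) fun n h₁ h₂ => ?_
    simp only [List.getElem_reverse, List.getElem_ofFn, List.length_ofFn, Equiv.arrowCongr_apply,
      Function.comp_apply, Equiv.refl_apply, Fin.revPerm_symm, Fin.revPerm_apply]
    congr 1
    ext
    simp only [Fin.val_rev]
    omega
  rw [sigCoeff, hrev, sigLevel]

lemma sum_sq_sigCoeff_sub (x y : ℝ → Fin d → ℝ) (T : ℝ) (k : ℕ) :
    ∑ w : Fin k → Fin d, (sigCoeff x T (List.ofFn w) - sigCoeff y T (List.ofFn w)) ^ 2
      = euclNorm (fun w => sigLevel x k T w - sigLevel y k T w) ^ 2 := by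
  simp only [sigCoeff_ofFn, sq_euclNorm]
  exact (Fin.revPerm.arrowCongr (Equiv.refl (Fin d))).sum_comp
    fun w => (sigLevel x k T w - sigLevel y k T w) ^ 2

lemma oneVar_congr {x y : ℝ → Fin d → ℝ} {T : ℝ} (hT : 0 ≤ T)
    (hxy : ∀ t ∈ Set.Icc 0 T, x t = y t) : oneVar x T = oneVar y T := by
  refine intervalIntegral.integral_congr fun s hs => ?_
  rw [Set.uIcc_of_le hT] at hs
  simp only [hxy s hs]

lemma oneVar_nonneg (x : ℝ → Fin d → ℝ) {T : ℝ} (hT : 0 ≤ T) : 0 ≤ oneVar x T :=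
  intervalIntegral.integral_nonneg hT fun _ _ => Real.sqrt_nonneg _

/-- A path derivative that is continuous on `[0, T]` agrees there with a continuous one. -/
lemma exists_continuous_extension {x : ℝ → Fin d → ℝ} {T : ℝ} (hT : 0 ≤ T)
    (hx : ∀ i, ContinuousOn (fun t => x t i) (Set.Icc 0 T)) :
    ∃ y : ℝ → Fin d → ℝ, (∀ i, Continuous fun t => y t i) ∧ ∀ t ∈ Set.Icc 0 T, x t = y t := by
  refine ⟨fun t => x (max 0 (min t T)), fun i => ?_, fun t ht => ?_⟩
  · exact (hx i).comp_continuous (by fun_prop)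
      fun t => ⟨le_max_left _ _, max_le hT (min_le_right _ _)⟩
  · simp only [min_eq_left ht.2, max_eq_right ht.1]

lemma sum_sq_sigCoeff_sub_le_of_continuous {x y : ℝ → Fin d → ℝ} {T : ℝ} (hT : 0 ≤ T)
    (hx : ∀ i, Continuous fun t => x t i) (hy : ∀ i, Continuous fun t => y t i) (n : ℕ) :
    ∑ k ∈ Finset.range n, ∑ w : Fin k → Fin d,
        (sigCoeff x T (List.ofFn w) - sigCoeff y T (List.ofFn w)) ^ 2
      ≤ (oneVar (fun t i => x t i - y t i) T * Real.exp (oneVar x T + oneVar y T)) ^ 2 := by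
  have hcx := continuous_euclNorm hx
  have hcy := continuous_euclNorm hy
  have hsum : ∫ s in (0:ℝ)..T, (euclNorm (x s) + euclNorm (y s)) = oneVar x T + oneVar y T :=
    intervalIntegral.integral_add (hcx.intervalIntegrable 0 T) (hcy.intervalIntegrable 0 T)
  have hlevel : ∀ k, euclNorm (fun w => sigLevel x (k + 1) T w - sigLevel y (k + 1) T w)
      ≤ oneVar (fun t i => x t i - y t i) T
        * ((oneVar x T + oneVar y T) ^ k / (k.factorial : ℝ)) := fun k => by
    rw [← hsum]
    exact euclNorm_sigLevel_sub_le hx hy (hcx.add hcy)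
      (fun s => le_add_of_nonneg_right (euclNorm_nonneg _))
      (fun s => le_add_of_nonneg_left (euclNorm_nonneg _)) k T hT
  simp only [sum_sq_sigCoeff_sub]
  refine (Finset.sum_le_sum_of_subset_of_nonneg
    (Finset.range_subset_range.2 n.le_succ) fun _ _ _ => sq_nonneg _).trans ?_
  refine (Finset.sum_sq_le_sq_sum_of_nonneg fun _ _ => euclNorm_nonneg _).trans ?_
  refine pow_le_pow_left₀ (Finset.sum_nonneg fun _ _ => euclNorm_nonneg _) ?_ 2
  rw [Finset.sum_range_succ', euclNorm_sigLevel_zero_sub, add_zero]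
  refine (Finset.sum_le_sum fun k _ => hlevel k).trans ?_
  rw [← Finset.mul_sum]
  exact mul_le_mul_of_nonneg_left
    (Real.sum_le_exp_of_nonneg (add_nonneg (oneVar_nonneg x hT) (oneVar_nonneg y hT)) n)
    (oneVar_nonneg _ hT)

/-- Local Lipschitz estimate for the signature with respect to the 1-variation. -/
lemma sum_sq_sigCoeff_sub_le {x y : ℝ → Fin d → ℝ} {T : ℝ} (hT : 0 ≤ T)
    (hx : ∀ i, ContinuousOn (fun t => x t i) (Set.Icc 0 T))
    (hy : ∀ i, ContinuousOn (fun t => y t i) (Set.Icc 0 T)) (n : ℕ) :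
    ∑ k ∈ Finset.range n, ∑ w : Fin k → Fin d,
        (sigCoeff x T (List.ofFn w) - sigCoeff y T (List.ofFn w)) ^ 2
      ≤ (oneVar (fun t i => x t i - y t i) T * Real.exp (oneVar x T + oneVar y T)) ^ 2 := by
  obtain ⟨x₁, hx₁, hxx₁⟩ := exists_continuous_extension hT hx
  obtain ⟨y₁, hy₁, hyy₁⟩ := exists_continuous_extension hT hy
  have hdiff : oneVar (fun t i => x t i - y t i) T = oneVar (fun t i => x₁ t i - y₁ t i) T :=
    oneVar_congr hT fun t ht => by simp only [hxx₁ t ht, hyy₁ t ht]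
  have hTT : T ∈ Set.Icc 0 T := ⟨hT, le_rfl⟩
  simp only [hdiff, oneVar_congr hT hxx₁, oneVar_congr hT hyy₁, sigCoeff,
    sigAux_congr hxx₁ _ T hTT, sigAux_congr hyy₁ _ T hTT]
  exact sum_sq_sigCoeff_sub_le_of_continuous hT hx₁ hy₁ n

lemma rhoSig_le_ofReal_iff (x y : ℝ → Fin d → ℝ) (T : ℝ) {h : ℝ} (hh : 0 ≤ h) :
    rhoSig x y T ≤ ENNReal.ofReal h ↔ ∀ n, ∑ k ∈ Finset.range n, ∑ w : Fin k → Fin d,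
      (sigCoeff x T (List.ofFn w) - sigCoeff y T (List.ofFn w)) ^ 2 ≤ h ^ 2 := by
  have hpartial : ∀ n, ∑ k ∈ Finset.range n, ∑ w : Fin k → Fin d, ENNReal.ofReal
        ((sigCoeff x T (List.ofFn w) - sigCoeff y T (List.ofFn w)) ^ 2)
      = ENNReal.ofReal (∑ k ∈ Finset.range n, ∑ w : Fin k → Fin d,
        (sigCoeff x T (List.ofFn w) - sigCoeff y T (List.ofFn w)) ^ 2) := fun n => by
    rw [ENNReal.ofReal_sum_of_nonneg fun _ _ => Finset.sum_nonneg fun _ _ => sq_nonneg _]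
    exact Finset.sum_congr rfl fun k _ =>
      (ENNReal.ofReal_sum_of_nonneg fun _ _ => sq_nonneg _).symm
  have hsq : rhoSig x y T ≤ ENNReal.ofReal h ↔ (∑' k : ℕ, ∑ w : Fin k → Fin d, ENNReal.ofReal
        ((sigCoeff x T (List.ofFn w) - sigCoeff y T (List.ofFn w)) ^ 2))
      ≤ ENNReal.ofReal (h ^ 2) := by
    rw [rhoSig, one_div, ENNReal.rpow_inv_le_iff two_pos, ENNReal.rpow_two,
      ENNReal.ofReal_pow hh]
  rw [hsq]
  refine ⟨fun hle n => ?_, fun hle => ENNReal.tsum_le_of_sum_range_le fun n => ?_⟩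
  · rw [← ENNReal.ofReal_le_ofReal_iff (sq_nonneg h), ← hpartial]
    exact (ENNReal.sum_le_tsum _).trans hle
  · rw [hpartial]
    exact ENNReal.ofReal_le_ofReal (hle n)

end Distance

lemma exp_two_mul_le (r : ℝ) :
    Real.exp (2 * r) ≤ Real.exp r + r * Real.exp (2 * r) := by
  have h₁ : Real.exp r = Real.exp (-r) * Real.exp (2 * r) := by
    rw [← Real.exp_add]
    ring_nf
  have h₂ := mul_le_mul_of_nonneg_right (Real.add_one_le_exp (-r)) (Real.exp_pos (2 * r)).le
  linarith

/-- Lemma: small-ball comparison: for a random path `X` with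
`‖X‖_{1-var} ≤ 𝓡` a.s. and `C = (e^𝓡 + 𝓡·e^{2𝓡})⁻¹`,
`ℙ[ρ^Sig_{≤N}(X,x) ≤ h] ≥ ℙ[ρ^Sig(X,x) ≤ h] ≥ ℙ[‖X − x‖_{1-var} ≤ C·h]`. -/
theorem small_ball_comparison
    (d : ℕ) (hd : 1 ≤ d) (T : ℝ) (hT : 0 < T)
    {Ω : Type*} [MeasurableSpace Ω] (ℙ : Measure Ω) [IsProbabilityMeasure ℙ]
    (X X' : Ω → ℝ → Fin d → ℝ)
    (hXderiv : ∀ ω, ∀ i : Fin d, ∀ t ∈ Set.Icc (0:ℝ) T,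
      HasDerivAt (fun s => X ω s i) (X' ω t i) t)
    (hXcont : ∀ ω, ∀ i : Fin d, ContinuousOn (fun t => X' ω t i) (Set.Icc (0:ℝ) T))
    (𝓡 : ℝ) (h𝓡 : 0 < 𝓡)
    (hXbdd : ∀ᵐ ω ∂ℙ, oneVar (X' ω) T ≤ 𝓡)
    (x x' : ℝ → Fin d → ℝ)
    (hxderiv : ∀ i : Fin d, ∀ t ∈ Set.Icc (0:ℝ) T,
      HasDerivAt (fun s => x s i) (x' t i) t)
    (hxcont : ∀ i : Fin d, ContinuousOn (fun t => x' t i) (Set.Icc (0:ℝ) T))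
    (hxbdd : oneVar x' T ≤ 𝓡)
    (C : ℝ) (hC : C = (Real.exp 𝓡 + 𝓡 * Real.exp (2 * 𝓡))⁻¹)
    (N : ℕ) (h : ℝ) (hh : 0 < h) :
    ℙ {ω | rhoSigTrunc (X' ω) x' T N ≤ h}
        ≥ ℙ {ω | rhoSig (X' ω) x' T ≤ ENNReal.ofReal h} ∧
    ℙ {ω | rhoSig (X' ω) x' T ≤ ENNReal.ofReal h}
        ≥ ℙ {ω | oneVar (fun t i => X' ω t i - x' t i) T ≤ C * h} := by
  constructor
  · refine measure_mono fun ω hω => ?_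
    exact Real.sqrt_le_iff.2 ⟨hh.le, (rhoSig_le_ofReal_iff _ _ T hh.le).1 hω (N + 1)⟩
  · refine measure_mono_ae ?_
    filter_upwards [hXbdd] with ω hω hdist
    refine (rhoSig_le_ofReal_iff _ _ T hh.le).2 fun n => ?_
    refine (sum_sq_sigCoeff_sub_le hT.le (hXcont ω) hxcont n).trans ?_
    refine pow_le_pow_left₀ (mul_nonneg (oneVar_nonneg _ hT.le) (Real.exp_pos _).le) ?_ 2
    have hK : 0 < Real.exp 𝓡 + 𝓡 * Real.exp (2 * 𝓡) := by positivity
    have hdist' : oneVar (fun t i => X' ω t i - x' t i) T ≤ C * h := hdist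
    calc _ ≤ C * h * (Real.exp 𝓡 + 𝓡 * Real.exp (2 * 𝓡)) :=
          mul_le_mul hdist' ((Real.exp_le_exp.2 (by linarith)).trans (exp_two_mul_le 𝓡))
            (Real.exp_pos _).le ((oneVar_nonneg _ hT.le).trans hdist')
      _ = h := by rw [hC]; field_simp
end
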